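/- Let J(γ) = ∫₀^{τ/i} θ′(2iy+γ)/θ(2iy+γ) dy, defined for γ ∉ ℤ + iℝ, where θ′ is the derivative of θ. Then J(γ) = 2π(1/2 − γ − τ) whenever 0 < Re(γ) < 1, and J(γ+1) = J(γ) for all γ ∉ ℤ + iℝ. -/

import Mathlib

noncomputable section
open Complex MeasureTheory

def cπ : ℂ := Real.pi

/-- Jacobi's first theta function θ₁(x|τ). -/
def θf (τ x : ℂ) : ℂ :=
  I * ∑' n : ℤ, (-1 : ℂ) ^ n *
    Complex.exp (cπ * I * τ * ((n : ℂ) - 1/2)^2 + cπ * I * (2*(n : ℂ) - 1) * x)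

/-- The space Θ_N of even theta functions of order 2N. -/
def ThetaSp (τ : ℂ) (N : ℕ) (f : ℂ → ℂ) : Prop :=
  Differentiable ℂ f ∧ (∀ x, f (x + 1) = f x) ∧
  (∀ x, f (x + τ) = Complex.exp (-2*cπ*I*N*(2*x + τ)) * f x) ∧
  (∀ x, f (-x) = f x)

/-- Sklyanin's weight function M(u,v). -/
def Mw (τ η : ℂ) (N : ℕ) (u v : ℂ) : ℂ :=
  θf τ (2*u) * θf τ (2*v) /
    (Complex.exp (2*cπ*I*u*(N+2)) *
      ∏ k ∈ Finset.range (N+2),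
        (θf τ (u + v + (2*(k:ℂ) - N - 1)*η + 1/2 + τ/2) *
         θf τ (u - v + (2*(k:ℂ) - N - 1)*η + 1/2 + τ/2)))

/-- Sklyanin's invariant pairing, with τ = t * I. -/
def pairing (τ η : ℂ) (t : ℝ) (N : ℕ) (f g : ℂ → ℂ) : ℂ :=
  ∫ y in (0:ℝ)..t, ∫ x in (0:ℝ)..(1:ℝ),
    f (x + y*I) * (starRingEnd ℂ) (g (x + y*I)) *
      Mw τ η N (x + y*I) ((starRingEnd ℂ) (x + y*I))

/-- The numerator defining the difference operator Δ(a). -/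
def ΔRHS (τ η : ℂ) (N : ℕ) (a₁ a₂ a₃ a₄ : ℂ) (f : ℂ → ℂ) (x : ℂ) : ℂ :=
  θf τ (x + a₁ - N*η/2) * θf τ (x + a₂ - N*η/2) * θf τ (x + a₃ - N*η/2) *
    θf τ (x + a₄ - N*η/2) * f (x + η)
  - θf τ (x - a₁ + N*η/2) * θf τ (x - a₂ + N*η/2) * θf τ (x - a₃ + N*η/2) *
    θf τ (x - a₄ + N*η/2) * f (x - η)

/-- The involution σ on Θ_N. -/
def σop (τ : ℂ) (N : ℕ) (f : ℂ → ℂ) (x : ℂ) : ℂ :=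
  Complex.exp (2*cπ*I*N*(1/4 + τ/4 + x)) * f (x + 1/2 + τ/2)

/-- q-Pochhammer infinite product (a;p)_∞. -/
def qPoch (a p : ℂ) : ℂ := ∏' j : ℕ, (1 - a * p^j)

/-- The constant C of Theorem 3.2. -/
def Cconst (τ η : ℂ) (N : ℕ) : ℂ :=
  2*η * Complex.exp (2*cπ*I*τ*(3/8)) /
    (θf τ (2*(N+1)*η) *
      (qPoch (Complex.exp (2*cπ*I*τ)) (Complex.exp (2*cπ*I*τ)))^3)

/-- The kernel K(u,w). -/
def Kk (τ η : ℂ) (N : ℕ) (u w : ℂ) : ℂ :=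
  Complex.exp (2*cπ*I*u*(N:ℂ)) *
  ∏ k ∈ Finset.range N,
    (θf τ (u + w + (2*(k:ℂ) - N + 1)*η + 1/2 + τ/2) *
     θf τ (u - w + (2*(k:ℂ) - N + 1)*η + 1/2 + τ/2))

/-- The basis functions e_k^N(x;a,b). -/
def ekN (τ η : ℂ) (N k : ℕ) (a b : ℂ) (x : ℂ) : ℂ :=
  (∏ j ∈ Finset.range k, (θf τ (a + x + 2*(j:ℂ)*η) * θf τ (a - x + 2*(j:ℂ)*η))) *
  (∏ j ∈ Finset.range (N - k), (θf τ (b + x + 2*(j:ℂ)*η) * θf τ (b - x + 2*(j:ℂ)*η)))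

/-- Elliptic number [x] = θ(2ηx). -/
def ell (τ η x : ℂ) : ℂ := θf τ (2*η*x)

/-- Elliptic shifted factorial [x]_k. -/
def ellFac (τ η x : ℂ) (k : ℕ) : ℂ := ∏ j ∈ Finset.range k, ell τ η (x + j)


/-- The integral J(γ) = ∫₀^{τ/i} θ′(2iy+γ)/θ(2iy+γ) dy, with τ = t·i. -/
def Jint (τ : ℂ) (t : ℝ) (γ : ℂ) : ℂ :=
  ∫ y in (0:ℝ)..t, deriv (θf τ) (2*I*(y:ℂ) + γ) / θf τ (2*I*(y:ℂ) + γ)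

section TripleProduct
open Filter Topology

/-- Partial q-factorial. -/
def tpPhi (q : ℂ) (n : ℕ) : ℂ := ∏ j ∈ Finset.range n, (1 - q ^ (j + 1))

/-- Reciprocal of the partial q-factorial, extended by zero to negative integers. -/
def tpW (q : ℂ) (k : ℤ) : ℂ := if 0 ≤ k then (tpPhi q k.toNat)⁻¹ else 0

lemma tp_one_sub_ne {q : ℂ} (hq1 : ‖q‖ < 1) (n : ℕ) : 1 - q ^ (n + 1) ≠ 0 := by
  intro h
  have h1 : q ^ (n + 1) = 1 := (sub_eq_zero.mp h).symm
  have h2 : ‖q‖ ^ (n + 1) = 1 := by rw [← norm_pow, h1, norm_one]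
  have h3 : ‖q‖ ^ (n + 1) < 1 := pow_lt_one₀ (norm_nonneg _) hq1 (by omega)
  linarith

lemma tpPhi_ne {q : ℂ} (hq1 : ‖q‖ < 1) (n : ℕ) : tpPhi q n ≠ 0 :=
  Finset.prod_ne_zero_iff.mpr fun j _ => tp_one_sub_ne hq1 j

lemma tpW_rec {q : ℂ} (hq1 : ‖q‖ < 1) (k : ℤ) :
    tpW q (k - 1) = (1 - q ^ k) * tpW q k := by
  rcases lt_trichotomy k 0 with h | h | h
  · simp [tpW, not_le.mpr h]
    intro; omega
  · subst h; simp [tpW]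
  · obtain ⟨n, rfl⟩ : ∃ n : ℕ, k = n + 1 := ⟨(k - 1).toNat, by omega⟩
    have h1 : ((n : ℤ) + 1 - 1) = n := by ring
    have h2 : ((n : ℤ) + 1).toNat = n + 1 := by omega
    have h3 : (0 : ℤ) ≤ (n : ℤ) + 1 := by omega
    rw [h1]
    simp only [tpW, h2, h3, if_true, Int.natCast_nonneg, Int.toNat_natCast]
    have h4 := tp_one_sub_ne hq1 n
    have h5 := tpPhi_ne hq1 n
    have h6 : tpPhi q (n + 1) = tpPhi q n * (1 - q ^ (n + 1)) := Finset.prod_range_succ _ _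
    have h7 : q ^ ((n : ℤ) + 1) = q ^ (n + 1) := by exact_mod_cast zpow_natCast q (n + 1)
    rw [h6, h7]
    field_simp

/-- Finite sums in the finite triple product. -/
def tpT (q : ℂ) (e : ℤ → ℂ) (n : ℕ) (k : ℤ) : ℂ := e k * (tpW q (n - k) * tpW q (n + k))

lemma tpT_zero {q : ℂ} {e : ℤ → ℂ} {n : ℕ} {k : ℤ} (h : k ∉ Finset.Icc (-(n : ℤ)) n) :
    tpT q e n k = 0 := by
  simp only [Finset.mem_Icc, not_and_or, not_le] at h
  rcases h with h | h
  · have : ¬ (0 ≤ (n : ℤ) + k) := by omega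
    simp [tpT, tpW, this]
  · have : ¬ (0 ≤ (n : ℤ) - k) := by omega
    rw [tpT, tpW, if_neg this, zero_mul, mul_zero]

lemma tpT_summable (q : ℂ) (e g : ℤ → ℂ) (n : ℕ) : Summable fun k => g k * tpT q e n k :=
  summable_of_ne_finset_zero (s := Finset.Icc (-(n : ℤ)) n) fun k hk => by
    rw [tpT_zero hk, mul_zero]

lemma tp_step {q z : ℂ} (hq : q ≠ 0) (hz : z ≠ 0) (hq1 : ‖q‖ < 1) {e : ℤ → ℂ}
    (he : ∀ k, e (k + 1) = -(q ^ k * z * e k)) (n : ℕ) :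
    (∑' k, tpT q e (n + 1) k) * ((1 - q ^ (2 * n + 1)) * (1 - q ^ (2 * n + 2))) =
      (∑' k, tpT q e n k) * ((1 - z * q ^ n) * (1 - q ^ (n + 1) / z)) := by
  have A := tpT_summable q e (fun _ => 1 + q ^ (2 * n + 1)) n
  have B := tpT_summable q e (fun _ => -(z * q ^ n)) n
  have C := tpT_summable q e (fun _ => -(q ^ (n + 1) / z)) n
  have B' := (Equiv.subRight (1 : ℤ)).summable_iff.mpr B
  have C' := (Equiv.addRight (1 : ℤ)).summable_iff.mpr C
  have eB := (Equiv.subRight (1 : ℤ)).tsum_eq (fun k => -(z * q ^ n) * tpT q e n k)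
  have eC := (Equiv.addRight (1 : ℤ)).tsum_eq (fun k => -(q ^ (n + 1) / z) * tpT q e n k)
  have key : (∑' k, tpT q e n k) * ((1 - z * q ^ n) * (1 - q ^ (n + 1) / z)) =
      (∑' k, (1 + q ^ (2 * n + 1)) * tpT q e n k) + (∑' k, -(z * q ^ n) * tpT q e n k)
        + (∑' k, -(q ^ (n + 1) / z) * tpT q e n k) := by
    rw [tsum_mul_left, tsum_mul_left, tsum_mul_left]
    field_simp
    ring
  simp only [Function.comp_def] at B' C'
  rw [key, ← eB, ← eC, ← A.tsum_add B', ← (A.add B').tsum_add C', ← tsum_mul_right]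
  refine tsum_congr fun k => ?_
  simp only [Equiv.subRight_apply, Equiv.coe_addRight, tpT]
  have w1 := tpW_rec hq1 ((n : ℤ) + 1 - k)
  have w2 := tpW_rec hq1 ((n : ℤ) + 1 + k)
  have w3 := tpW_rec hq1 ((n : ℤ) - k)
  have w4 := tpW_rec hq1 ((n : ℤ) + k)
  have i1 : (n : ℤ) + 1 - k - 1 = n - k := by ring
  have i2 : (n : ℤ) + 1 + k - 1 = n + k := by ring
  have i3 : (n : ℤ) - (k - 1) = n + 1 - k := by ring
  have i4 : (n : ℤ) + (k - 1) = n + k - 1 := by ring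
  have i5 : (n : ℤ) - (k + 1) = n - k - 1 := by ring
  have i6 : (n : ℤ) + (k + 1) = n + 1 + k := by ring
  have e1 := he (k - 1)
  rw [sub_add_cancel] at e1
  have e2 := he k
  rw [i1] at w1
  rw [i2] at w2
  rw [w1] at w3
  rw [w2] at w4
  rw [i3, i4, i5, i6, w3, w4, w1, w2]
  push_cast
  set U := tpW q ((n : ℤ) + 1 - k)
  set V := tpW q ((n : ℤ) + 1 + k)
  have hk : q ^ k ≠ 0 := zpow_ne_zero _ hq
  have z1 : q ^ ((n : ℤ) + 1 - k) = q ^ n * q / q ^ k := by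
    rw [zpow_sub₀ hq, zpow_add₀ hq, zpow_one, zpow_natCast]
  have z2 : q ^ ((n : ℤ) + 1 + k) = q ^ n * q * q ^ k := by
    rw [zpow_add₀ hq, zpow_add₀ hq, zpow_one, zpow_natCast]
  have z3 : q ^ ((n : ℤ) - k) = q ^ n / q ^ k := by
    rw [zpow_sub₀ hq, zpow_natCast]
  have z4 : q ^ ((n : ℤ) + k) = q ^ n * q ^ k := by
    rw [zpow_add₀ hq, zpow_natCast]
  have z5 : q ^ (k - 1) = q ^ k / q := by
    rw [zpow_sub₀ hq, zpow_one]
  rw [z5] at e1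
  have e3 : e (k - 1) = -(q * e k / (q ^ k * z)) := by
    rw [e1]; field_simp
  rw [z1, z2, z3, z4, e3, e2]
  have p1 : q ^ (2 * n + 1) = q ^ n * q ^ n * q := by ring
  have p2 : q ^ (2 * n + 2) = q ^ n * q ^ n * q * q := by ring
  have p3 : q ^ (n + 1) = q ^ n * q := by ring
  rw [p1, p2, p3]
  set Q := q ^ n
  set K := q ^ k
  field_simp
  ring

lemma tp_finite {q z : ℂ} (hq : q ≠ 0) (hz : z ≠ 0) (hq1 : ‖q‖ < 1) {e : ℤ → ℂ}
    (he : ∀ k, e (k + 1) = -(q ^ k * z * e k)) (n : ℕ) :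
    tpPhi q (2 * n) * (∑' k, tpT q e n k) =
      e 0 * ((∏ j ∈ Finset.range n, (1 - z * q ^ j)) *
        ∏ j ∈ Finset.range n, (1 - q ^ (j + 1) / z)) := by
  induction n with
  | zero =>
    rw [tsum_eq_single 0]
    · simp [tpT, tpW, tpPhi]
    · intro k hk
      apply tpT_zero
      simp; omega
  | succ n ih =>
    have s := tp_step hq hz hq1 he n
    have h : tpPhi q (2 * (n + 1)) =
        tpPhi q (2 * n) * ((1 - q ^ (2 * n + 1)) * (1 - q ^ (2 * n + 2))) := by
      rw [show 2 * (n + 1) = 2 * n + 1 + 1 by ring, tpPhi, Finset.prod_range_succ,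
        Finset.prod_range_succ, tpPhi, mul_assoc]
    rw [Finset.prod_range_succ, Finset.prod_range_succ, h]
    linear_combination tpPhi q (2 * n) * s +
      ((1 - z * q ^ n) * (1 - q ^ (n + 1) / z)) * ih

lemma tp_summable {q : ℂ} (hq1 : ‖q‖ < 1) (c : ℂ) : Summable fun j : ℕ => ‖-(c * q ^ j)‖ := by
  simp only [norm_neg, norm_mul, norm_pow]
  exact (summable_geometric_of_lt_one (norm_nonneg _) hq1).mul_left _

lemma tp_prod {q : ℂ} (hq1 : ‖q‖ < 1) (c : ℂ) (hc : ∀ j : ℕ, 1 - c * q ^ j ≠ 0) :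
    ∃ L : ℂ, L ≠ 0 ∧ Tendsto (fun n => ∏ j ∈ Finset.range n, (1 - c * q ^ j)) atTop (𝓝 L) := by
  have hs := tp_summable hq1 c
  refine ⟨∏' j : ℕ, (1 + -(c * q ^ j)), ?_, ?_⟩
  · exact tprod_one_add_ne_zero_of_summable (fun j => by simpa [← sub_eq_add_neg] using hc j) hs
  · simpa [← sub_eq_add_neg] using
      (multipliable_one_add_of_summable hs).hasProd.tendsto_prod_nat

lemma tp_ne_zero {q z : ℂ} (hq : q ≠ 0) (hz : z ≠ 0) (hq1 : ‖q‖ < 1) {e : ℤ → ℂ}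
    (he : ∀ k, e (k + 1) = -(q ^ k * z * e k)) (he0 : e 0 ≠ 0) (hes : Summable e)
    (h1 : ∀ j : ℕ, 1 - z * q ^ j ≠ 0) (h2 : ∀ j : ℕ, 1 - q / z * q ^ j ≠ 0) :
    ∑' k, e k ≠ 0 := by
  obtain ⟨L1, hL1, t1⟩ := tp_prod hq1 z h1
  obtain ⟨L2, hL2, t2⟩ := tp_prod hq1 (q / z) h2
  obtain ⟨L, hL, t⟩ := tp_prod hq1 q
    (fun j => by simpa [pow_succ'] using tp_one_sub_ne hq1 j)
  have tphi : Tendsto (tpPhi q) atTop (𝓝 L) := by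
    refine t.congr fun n => ?_
    simp [tpPhi, pow_succ']
  have tinv : Tendsto (fun n => (tpPhi q n)⁻¹) atTop (𝓝 L⁻¹) := tphi.inv₀ hL
  obtain ⟨M, hM⟩ : ∃ M : ℝ, ∀ n, ‖(tpPhi q n)⁻¹‖ ≤ M := by
    obtain ⟨M, hM⟩ := (Metric.isBounded_range_of_tendsto _ tinv).exists_norm_le
    exact ⟨M, fun n => hM _ ⟨n, rfl⟩⟩
  have hM0 : 0 ≤ M := (norm_nonneg _).trans (hM 0)
  have hW : ∀ k, ‖tpW q k‖ ≤ M := by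
    intro k
    unfold tpW
    split_ifs
    · exact hM _
    · simpa using hM0
  have tW : Tendsto (tpW q) atTop (𝓝 L⁻¹) := by
    have : Tendsto (fun k : ℤ => (tpPhi q k.toNat)⁻¹) atTop (𝓝 L⁻¹) :=
      tinv.comp (tendsto_atTop_atTop.mpr fun b => ⟨b, fun a ha => by omega⟩)
    refine this.congr' ?_
    filter_upwards [eventually_ge_atTop 0] with k hk
    simp [tpW, hk]
  have tsumT : Tendsto (fun n : ℕ => ∑' k, tpT q e n k) atTop
      (𝓝 (∑' k, e k * (L⁻¹ * L⁻¹))) := by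
    refine tendsto_tsum_of_dominated_convergence (bound := fun k => ‖e k‖ * (M * M)) ?_ ?_ ?_
    · exact hes.norm.mul_right _
    · intro k
      refine tendsto_const_nhds.mul (Tendsto.mul ?_ ?_)
      · exact tW.comp (tendsto_atTop_atTop.mpr fun b => ⟨(b + k).toNat, fun a ha => by omega⟩)
      · exact tW.comp (tendsto_atTop_atTop.mpr fun b => ⟨(b - k).toNat, fun a ha => by omega⟩)
    · refine Eventually.of_forall fun n k => ?_
      rw [tpT, norm_mul, norm_mul]
      gcongr
      · exact hW _
      · exact hW _
  have tleft := (tphi.comp (tendsto_atTop_atTop.mpr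
    fun b => ⟨b, fun a (ha : b ≤ a) => (by omega : b ≤ 2 * a)⟩)).mul tsumT
  have tright := (t1.mul t2).const_mul (e 0)
  have heq := tendsto_nhds_unique tleft (tright.congr fun n => by
    have := tp_finite hq hz hq1 he n
    simp only [Function.comp]
    rw [this]
    congr 2
    refine Finset.prod_congr rfl fun j _ => ?_
    rw [pow_succ']; ring)
  intro h0
  rw [tsum_mul_right, h0] at heq
  simp [he0, hL1, hL2] at heq

end TripleProduct

section ThetaFacts
open Filter Topology

lemma th_term (τ x : ℂ) (n : ℤ) :
    (-1 : ℂ) ^ n *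
      Complex.exp (cπ * I * τ * ((n : ℂ) - 1/2)^2 + cπ * I * (2*(n : ℂ) - 1) * x) =
    Complex.exp (cπ * I * τ / 4 - cπ * I * x) * jacobiTheta₂_term n (x + 1/2 - τ/2) τ := by
  have h : (-1 : ℂ) ^ n = Complex.exp (n * (cπ * I)) := by
    rw [Complex.exp_int_mul, cπ, Complex.exp_pi_mul_I]
  rw [h, jacobiTheta₂_term, ← Complex.exp_add, ← Complex.exp_add]
  congr 1
  simp only [cπ]
  ring

lemma th_eq (τ x : ℂ) : θf τ x =
    I * (Complex.exp (cπ * I * τ / 4 - cπ * I * x) * jacobiTheta₂ (x + 1/2 - τ/2) τ) := by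
  rw [θf, jacobiTheta₂]
  congr 1
  rw [← tsum_mul_left]
  exact tsum_congr fun n => th_term τ x n

lemma th_diff {τ : ℂ} (hτ : 0 < τ.im) : Differentiable ℂ (θf τ) := by
  have : θf τ = fun x => I * (Complex.exp (cπ * I * τ / 4 - cπ * I * x) *
      jacobiTheta₂ (x + 1/2 - τ/2) τ) := funext (th_eq τ)
  rw [this]
  intro x
  have h := (differentiableAt_jacobiTheta₂_fst (x + 1/2 - τ/2) hτ)
  have h2 : DifferentiableAt ℂ (fun x : ℂ => jacobiTheta₂ (x + 1/2 - τ/2) τ) x :=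
    DifferentiableAt.comp (g := fun z => jacobiTheta₂ z τ) (f := fun x => x + 1/2 - τ/2) x h
      (by fun_prop)
  fun_prop

lemma th_exp_pi : Complex.exp (-(cπ * I)) = -1 := by
  rw [Complex.exp_neg, cπ, Complex.exp_pi_mul_I]; norm_num

lemma th_add_one (τ x : ℂ) : θf τ (x + 1) = -θf τ x := by
  rw [th_eq, th_eq, show x + 1 + 1/2 - τ/2 = x + 1/2 - τ/2 + 1 by ring, jacobiTheta₂_add_left,
    show cπ * I * τ / 4 - cπ * I * (x + 1) = cπ * I * τ / 4 - cπ * I * x + -(cπ * I) by ring,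
    Complex.exp_add, th_exp_pi]
  ring

lemma th_add_tau (τ x : ℂ) :
    θf τ (x + τ) = -Complex.exp (-(cπ * I * τ) - 2 * cπ * I * x) * θf τ x := by
  rw [th_eq, th_eq, show x + τ + 1/2 - τ/2 = x + 1/2 - τ/2 + τ by ring, jacobiTheta₂_add_left']
  have h : Complex.exp (cπ * I * τ / 4 - cπ * I * (x + τ)) *
      Complex.exp (-Real.pi * I * (τ + 2 * (x + 1/2 - τ/2))) =
      -Complex.exp (-(cπ * I * τ) - 2 * cπ * I * x) *
        Complex.exp (cπ * I * τ / 4 - cπ * I * x) := by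
    have hn : ∀ a : ℂ, -Complex.exp a = Complex.exp (-(cπ * I) + a) := fun a => by
      rw [Complex.exp_add, th_exp_pi, neg_one_mul]
    rw [hn, ← Complex.exp_add, ← Complex.exp_add]
    congr 1
    simp only [cπ]
    ring
  linear_combination I * jacobiTheta₂ (x + 1/2 - τ/2) τ * h

lemma th_neg (τ x : ℂ) : θf τ (-x) = -θf τ x := by
  have h0 := jacobiTheta₂_add_left' (x + 1/2 - τ/2) τ
  rw [← jacobiTheta₂_neg_left, ← jacobiTheta₂_add_left,
    show -(x + 1/2 - τ/2 + τ) + 1 = -x + 1/2 - τ/2 by ring] at h0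
  rw [th_eq, th_eq, h0]
  have h : Complex.exp (cπ * I * τ / 4 - cπ * I * (-x)) *
      Complex.exp (-Real.pi * I * (τ + 2 * (x + 1/2 - τ/2))) =
        -Complex.exp (cπ * I * τ / 4 - cπ * I * x) := by
    have hn : ∀ a : ℂ, -Complex.exp a = Complex.exp (-(cπ * I) + a) := fun a => by
      rw [Complex.exp_add, th_exp_pi, neg_one_mul]
    rw [hn, ← Complex.exp_add]
    congr 1
    simp only [cπ]
    ring
  linear_combination I * jacobiTheta₂ (x + 1/2 - τ/2) τ * h

lemma th_ne_zero {t : ℝ} (ht : 0 < t) {x : ℂ} (hx : ∀ n : ℤ, x.re ≠ n) :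
    θf (t * I) x ≠ 0 := by
  set τ : ℂ := t * I with hτ
  have him : 0 < τ.im := by simp [hτ, ht]
  have hexp : ∀ m : ℤ, ∀ s : ℂ, (s = 1 ∨ s = -1) →
      1 - Complex.exp (2 * cπ * I * (s * x + m * τ)) ≠ 0 := by
    intro m s hs h
    have h1 := (sub_eq_zero.mp h).symm
    rw [Complex.exp_eq_one_iff] at h1
    obtain ⟨n, hn⟩ := h1
    have h2 : s * x + m * τ = n := by
      have : (2 * (Real.pi : ℂ) * I) ≠ 0 := Complex.two_pi_I_ne_zero
      apply mul_left_cancel₀ this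
      rw [cπ] at hn
      rw [hn]; ring
    have h3 := congrArg Complex.re h2
    rcases hs with rfl | rfl
    · simp [hτ] at h3
      exact hx n h3
    · simp [hτ] at h3
      exact hx (-n) (by push_cast; linarith)
  set q := Complex.exp (2 * cπ * I * τ) with hqd
  set z := Complex.exp (2 * cπ * I * x) with hzd
  have hq : q ≠ 0 := Complex.exp_ne_zero _
  have hz : z ≠ 0 := Complex.exp_ne_zero _
  have hq1 : ‖q‖ < 1 := by
    rw [hqd, Complex.norm_exp, Real.exp_lt_one_iff]
    simp [hτ, cπ]
    positivity
  unfold θf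
  refine mul_ne_zero I_ne_zero (tp_ne_zero hq hz hq1 ?_ ?_ ?_ ?_ ?_)
  · intro k
    rw [hqd, hzd, ← Complex.exp_int_mul, zpow_add₀ (by norm_num), zpow_one]
    have : Complex.exp (cπ * I * τ * (((k + 1 : ℤ) : ℂ) - 1/2)^2
          + cπ * I * (2*((k + 1 : ℤ) : ℂ) - 1) * x) =
        Complex.exp (k * (2 * cπ * I * τ)) * Complex.exp (2 * cπ * I * x) *
        Complex.exp (cπ * I * τ * ((k : ℂ) - 1/2)^2 + cπ * I * (2*(k : ℂ) - 1) * x) := by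
      rw [← Complex.exp_add, ← Complex.exp_add]
      congr 1
      push_cast
      ring
    rw [this]
    ring
  · simp [Complex.exp_ne_zero]
  · simp_rw [th_term]
    exact ((summable_jacobiTheta₂_term_iff _ τ).mpr him).mul_left _
  · intro j
    have := hexp j 1 (Or.inl rfl)
    rw [hqd, hzd, ← Complex.exp_nat_mul, ← Complex.exp_add]
    convert this using 3
    push_cast
    ring
  · intro j
    have := hexp (j + 1) (-1) (Or.inr rfl)
    rw [hqd, hzd, ← Complex.exp_nat_mul, ← Complex.exp_sub, ← Complex.exp_add]
    convert this using 3
    push_cast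
    ring

/-- The logarithmic derivative. -/
def thL (τ x : ℂ) : ℂ := deriv (θf τ) x / θf τ x

lemma thL_add_one (τ x : ℂ) : thL τ (x + 1) = thL τ x := by
  have h : (fun y => θf τ (y + 1)) = fun y => -θf τ y := funext (th_add_one τ)
  have h2 := congrArg (fun f => deriv f x) h
  simp only [deriv_comp_add_const, deriv.fun_neg] at h2
  rw [thL, thL, h2, th_add_one, neg_div_neg_eq]

lemma thL_neg (τ x : ℂ) : thL τ (-x) = -thL τ x := by
  have h : (fun y => θf τ (-y)) = fun y => -θf τ y := funext (th_neg τ)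
  have h2 := congrArg (fun f => deriv f x) h
  simp only [deriv_comp_neg, deriv.fun_neg, neg_inj] at h2
  rw [thL, thL, h2, th_neg, div_neg]

lemma thL_add_tau {τ : ℂ} (hτ : 0 < τ.im) {x : ℂ} (hx : θf τ x ≠ 0) :
    thL τ (x + τ) = thL τ x - 2 * cπ * I := by
  have h : (fun y => θf τ (y + τ)) =
      fun y => -Complex.exp (-(cπ * I * τ) - 2 * cπ * I * y) * θf τ y := funext (th_add_tau τ)
  have h2 := congrArg (fun f => deriv f x) h
  simp only [deriv_comp_add_const] at h2
  have hd : HasDerivAt (fun y : ℂ => -Complex.exp (-(cπ * I * τ) - 2 * cπ * I * y))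
      (-(Complex.exp (-(cπ * I * τ) - 2 * cπ * I * x) * (-(2 * cπ * I * 1)))) x :=
    ((((hasDerivAt_id' x).const_mul (2 * cπ * I)).const_sub (-(cπ * I * τ))).cexp).neg
  have h3 := (hd.mul (th_diff hτ x).hasDerivAt).deriv
  have h4 := h2.trans h3
  have he := Complex.exp_ne_zero (-(cπ * I * τ) - 2 * cπ * I * x)
  rw [thL, thL, h4, th_add_tau]
  field_simp
  ring

end ThetaFacts

section Integral
open Filter Topology Set

/-- The open strip. -/
def thS : Set ℂ := {z | 0 < z.re ∧ z.re < 1}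

lemma thS_open : IsOpen thS :=
  (isOpen_lt continuous_const Complex.continuous_re).inter
    (isOpen_lt Complex.continuous_re continuous_const)

lemma thS_convex : Convex ℝ thS :=
  (convex_halfSpace_re_gt 0).inter (convex_halfSpace_re_lt 1)

lemma thS_ne {t : ℝ} (ht : 0 < t) {x : ℂ} (hx : x ∈ thS) : θf (t * I) x ≠ 0 := by
  refine th_ne_zero ht fun n hn => ?_
  obtain ⟨h1, h2⟩ := hx
  rw [hn] at h1 h2
  have h3 : 0 < n := by exact_mod_cast h1
  have h4 : n < 1 := by exact_mod_cast h2
  omega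

lemma thS_shift {x : ℂ} (hx : x ∈ thS) (y : ℝ) : 2 * I * (y : ℂ) + x ∈ thS := by
  simpa [thS] using hx

lemma thL_diffOn {t : ℝ} (ht : 0 < t) : DifferentiableOn ℂ (thL (t * I)) thS := by
  have hd : Differentiable ℂ (θf (t * I)) := th_diff (by simpa using ht)
  have hd' : Differentiable ℂ (deriv (θf (t * I))) := hd.deriv
  intro x hx
  exact ((hd' x).div (hd x) (thS_ne ht hx)).differentiableWithinAt

lemma J_hasDeriv {t : ℝ} (ht : 0 < t) {γ : ℂ} (hγ : γ ∈ thS) :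
    HasDerivAt (fun g => ∫ y in (0:ℝ)..t, thL (t * I) (2 * I * (y : ℂ) + g)) (-(2 * cπ)) γ := by
  set f := thL (t * I) with hf
  have hfd : DifferentiableOn ℂ f thS := thL_diffOn ht
  have hf' : DifferentiableOn ℂ (deriv f) thS := hfd.deriv thS_open
  have hda : ∀ x ∈ thS, HasDerivAt f (deriv f x) x := fun x hx =>
    (hfd.differentiableAt (thS_open.mem_nhds hx)).hasDerivAt
  have hcont : ∀ g : ℂ → ℂ, ContinuousOn g thS → ∀ x ∈ thS,
      Continuous (fun y : ℝ => g (2 * I * (y : ℂ) + x)) := fun g hg x hx =>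
    hg.comp_continuous (by fun_prop) (fun y => thS_shift hx y)
  obtain ⟨r, hr, hball⟩ := Metric.nhds_basis_closedBall.mem_iff.mp (thS_open.mem_nhds hγ)
  have hK : IsCompact ((fun p : ℝ × ℂ => 2 * I * (p.1 : ℂ) + p.2) ''
      (Icc 0 t ×ˢ Metric.closedBall γ r)) :=
    (isCompact_Icc.prod (isCompact_closedBall γ r)).image (by fun_prop)
  have hKS : ((fun p : ℝ × ℂ => 2 * I * (p.1 : ℂ) + p.2) ''
      (Icc 0 t ×ˢ Metric.closedBall γ r)) ⊆ thS := by
    rintro _ ⟨⟨y, x⟩, ⟨_, hx⟩, rfl⟩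
    exact thS_shift (hball hx) y
  obtain ⟨M, hM⟩ := hK.exists_bound_of_continuousOn (hf'.continuousOn.mono hKS)
  have main := (intervalIntegral.hasDerivAt_integral_of_dominated_loc_of_deriv_le (μ := volume)
    (F := fun g (y : ℝ) => f (2 * I * (y : ℂ) + g))
    (F' := fun g (y : ℝ) => deriv f (2 * I * (y : ℂ) + g)) (x₀ := γ) (a := 0) (b := t)
    (s := Metric.ball γ r) (bound := fun _ => M) (Metric.ball_mem_nhds γ hr)
    (by
      filter_upwards [thS_open.mem_nhds hγ] with x hx
      exact (hcont f hfd.continuousOn x hx).aestronglyMeasurable)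
    ((hcont f hfd.continuousOn γ hγ).intervalIntegrable _ _)
    ((hcont _ hf'.continuousOn γ hγ).aestronglyMeasurable)
    (Eventually.of_forall fun y hy x hx => by
      refine hM _ ⟨(y, x), ⟨?_, Metric.ball_subset_closedBall hx⟩, rfl⟩
      rw [uIoc_of_le ht.le] at hy
      exact ⟨hy.1.le, hy.2⟩)
    intervalIntegrable_const
    (Eventually.of_forall fun y hy x hx => by
      have hxS := hball (Metric.ball_subset_closedBall hx)
      have := (hda _ (thS_shift hxS y)).comp x ((hasDerivAt_id' x).const_add (2 * I * (y : ℂ)))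
      rw [mul_one] at this
      exact this)).2
  have ftc : ∫ y in (0:ℝ)..t, deriv f (2 * I * (y : ℂ) + γ) = -(2 * cπ) := by
    have h1 : ∀ y : ℝ, HasDerivAt (fun y : ℝ => f (2 * I * (y : ℂ) + γ) / (2 * I))
        (deriv f (2 * I * (y : ℂ) + γ)) y := by
      intro y
      have hin : HasDerivAt (fun w : ℂ => 2 * I * w + γ) (2 * I) (y : ℂ) := by
        simpa using ((hasDerivAt_id' (y : ℂ)).const_mul (2 * I)).add_const γ
      have h2 := (((hda _ (thS_shift hγ y)).comp (y : ℂ) hin).div_const (2 * I)).comp_ofReal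
      have h3 : deriv f (2 * I * (y : ℂ) + γ) * (2 * I) / (2 * I) =
          deriv f (2 * I * (y : ℂ) + γ) := by
        field_simp
      rw [h3] at h2
      exact h2
    rw [intervalIntegral.integral_eq_sub_of_hasDerivAt (fun y _ => h1 y)
      ((hcont _ hf'.continuousOn γ hγ).intervalIntegrable _ _)]
    have him : 0 < ((t : ℂ) * I).im := by simpa using ht
    have a1 := thL_add_tau him (thS_ne ht hγ)
    have hγ2 : γ + t * I ∈ thS := by simpa [thS] using hγ
    have a2 := thL_add_tau him (thS_ne ht hγ2)
    have e1 : 2 * I * (t : ℂ) + γ = γ + t * I + t * I := by ring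
    have e2 : 2 * I * ((0 : ℝ) : ℂ) + γ = γ := by simp
    rw [e1, e2, hf, a2, a1]
    field_simp
    ring
  rw [ftc] at main
  exact main

lemma J_half {t : ℝ} (ht : 0 < t) :
    ∫ y in (0:ℝ)..t, thL (t * I) (2 * I * (y : ℂ) + 1/2) = -(2 * cπ * (t * I)) := by
  have hS : (1/2 : ℂ) ∈ thS := by
    have : (1/2 : ℂ) = ((1/2 : ℝ) : ℂ) := by push_cast; rfl
    rw [this]
    simp only [thS, mem_ofPred_eq, Complex.ofReal_re]
    norm_num
  have him : 0 < ((t : ℂ) * I).im := by simpa using ht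
  have hci : IntervalIntegrable (fun y : ℝ => thL (t * I) (2 * I * (y : ℂ) + 1/2)) volume 0 t :=
    ((thL_diffOn ht).continuousOn.comp_continuous (by fun_prop)
      (fun y => thS_shift hS y)).intervalIntegrable _ _
  have h1 := intervalIntegral.integral_comp_sub_left (a := 0) (b := t)
    (fun y : ℝ => thL (t * I) (2 * I * (y : ℂ) + 1/2)) t
  simp only [sub_self, sub_zero] at h1
  have h2 : ∀ y : ℝ, thL (t * I) (2 * I * ((t - y : ℝ) : ℂ) + 1/2) =
      -thL (t * I) (2 * I * (y : ℂ) + 1/2) - 4 * cπ * I := by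
    intro y
    have b0 : 2 * I * ((-y : ℝ) : ℂ) + 1/2 ∈ thS := thS_shift hS (-y)
    have b1 : 2 * I * ((-y : ℝ) : ℂ) + 1/2 + t * I ∈ thS := by
      have : (2 * I * ((-y : ℝ) : ℂ) + 1/2 + t * I) = 2 * I * ((-y + t / 2 : ℝ) : ℂ) + 1/2 := by
        push_cast; ring
      rw [this]
      exact thS_shift hS _
    have e1 : 2 * I * ((t - y : ℝ) : ℂ) + 1/2 = 2 * I * ((-y : ℝ) : ℂ) + 1/2 + t * I + t * I := by
      push_cast; ring
    rw [e1, thL_add_tau him (thS_ne ht b1), thL_add_tau him (thS_ne ht b0), ← thL_neg,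
      ← thL_add_one _ (-(2 * I * (y : ℂ) + 1/2))]
    have e2 : -(2 * I * (y : ℂ) + 1/2) + 1 = 2 * I * ((-y : ℝ) : ℂ) + 1/2 := by
      push_cast; ring
    rw [e2]
    ring
  simp_rw [h2] at h1
  have hcn : IntervalIntegrable (fun y : ℝ => -thL (t * I) (2 * I * (y : ℂ) + 1/2)) volume 0 t :=
    hci.neg
  rw [intervalIntegral.integral_sub hcn intervalIntegrable_const,
    intervalIntegral.integral_neg, intervalIntegral.integral_const] at h1
  simp only [sub_zero, Complex.real_smul] at h1
  linear_combination (-1/2 : ℂ) * h1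

end Integral

/-- J(γ) = 2π(1/2 − γ − τ) for 0 < Re γ < 1, and J(γ+1) = J(γ) for
γ ∉ ℤ + iℝ. -/
theorem theta_log_deriv_integral_y
    (t : ℝ) (ht : 0 < t) (τ : ℂ) (hτ : τ = t * I) (γ : ℂ) :
    ((0 < γ.re ∧ γ.re < 1) → Jint τ t γ = 2*cπ*(1/2 - γ - τ)) ∧
    ((¬ ∃ (n : ℤ) (r : ℝ), γ = (n : ℂ) + (r : ℂ) * I) →
      Jint τ t (γ + 1) = Jint τ t γ) := by
  subst hτ
  constructor
  · intro hγ
    have hS : γ ∈ thS := hγ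
    have hH : (1/2 : ℂ) ∈ thS := by
      have : (1/2 : ℂ) = ((1/2 : ℝ) : ℂ) := by push_cast; rfl
      rw [this]
      simp only [thS, Set.mem_ofPred_eq, Complex.ofReal_re]
      norm_num
    have hder : ∀ g ∈ thS, HasDerivAt (fun g =>
        (∫ y in (0:ℝ)..t, thL (t * I) (2 * I * (y : ℂ) + g)) + 2 * cπ * g) 0 g := by
      intro g hg
      have := (J_hasDeriv ht hg).add ((hasDerivAt_id' g).const_mul (2 * cπ))
      rw [mul_one, neg_add_cancel] at this
      exact this
    have hc := thS_open.is_const_of_deriv_eq_zero thS_convex.isPreconnected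
      (fun g hg => (hder g hg).differentiableAt.differentiableWithinAt)
      (fun g hg => (hder g hg).deriv) hS hH
    simp only [J_half ht] at hc
    change ∫ y in (0:ℝ)..t, thL (t * I) (2 * I * (y : ℂ) + γ) = _
    linear_combination hc
  · intro _
    change ∫ y in (0:ℝ)..t, thL (t * I) (2 * I * (y : ℂ) + (γ + 1)) =
      ∫ y in (0:ℝ)..t, thL (t * I) (2 * I * (y : ℂ) + γ)
    simp only [← add_assoc, thL_add_one]
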